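/- arXiv:1602.07328 — 4 statements merged into one kernel-verified Lean document; each statement's English description precedes it below -/
import Mathlib

section
/- Let C be an abelian category and let (X,ω) be a pair of classes of objects of C such that ω is X-injective. Then: (a) ω^∧ is X-injective, i.e. id_X(M) = 0 for every M ∈ ω^∧; (b) if in addition ω is a relative cogenerator in X and ω is closed under direct summands in C, then ω = {X ∈ X : id_X(X) = 0} = X ∩ ω^∧. -/
/-!
Common definitions for Auslander–Buchweitz approximation theory in abelian
categories, following Becerril–Mendoza–Pérez–Santiago.
-/

open CategoryTheory CategoryTheory.Limits ZeroObject

universe w v u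

namespace ABFormal

variable {C : Type u} [Category.{v} C] [Abelian C] [CategoryTheory.HasExt.{w} C]

/-- `0 → A → B → C' → 0` is a short exact sequence in `C`. -/
def IsShortExactSeq {A B C' : C} (f : A ⟶ B) (g : B ⟶ C') : Prop :=
  ∃ w : f ≫ g = 0, (ShortComplex.mk f g w).ShortExact

/-- `ωω` is `XX`-injective: `Ext^i(X, W) = 0` for all `X ∈ XX`, `W ∈ ωω` and `i > 0`. -/
def IsRelInjective (XX ωω : Set C) : Prop :=
  ∀ W ∈ ωω, ∀ X ∈ XX, ∀ i : ℕ, 0 < i → Subsingleton (Abelian.Ext.{w} X W i)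

/-- `ωω` is `XX`-projective: `Ext^i(W, X) = 0` for all `X ∈ XX`, `W ∈ ωω` and `i > 0`. -/
def IsRelProjective (XX ωω : Set C) : Prop :=
  ∀ W ∈ ωω, ∀ X ∈ XX, ∀ i : ℕ, 0 < i → Subsingleton (Abelian.Ext.{w} W X i)

/-- `ωω` is a relative cogenerator in `XX`. -/
def IsRelCogenerator (XX ωω : Set C) : Prop :=
  ωω ⊆ XX ∧ ∀ X ∈ XX, ∃ (W X' : C) (i : X ⟶ W) (p : W ⟶ X'),
    W ∈ ωω ∧ X' ∈ XX ∧ IsShortExactSeq i p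

/-- `ωω` is a relative generator in `XX`. -/
def IsRelGenerator (XX ωω : Set C) : Prop :=
  ωω ⊆ XX ∧ ∀ X ∈ XX, ∃ (X' W : C) (i : X' ⟶ W) (p : W ⟶ X),
    W ∈ ωω ∧ X' ∈ XX ∧ IsShortExactSeq i p

/-- `id_XX(M) ≤ n` : `Ext^j(X, M) = 0` for all `X ∈ XX` and `j > n`. -/
def relInjDimLE (XX : Set C) (M : C) (n : ℕ) : Prop :=
  ∀ X ∈ XX, ∀ j : ℕ, n < j → Subsingleton (Abelian.Ext.{w} X M j)

/-- The relative injective dimension `id_XX(M) : ℕ∞`. -/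
noncomputable def relInjDim (XX : Set C) (M : C) : ℕ∞ :=
  sInf {m : ℕ∞ | ∃ n : ℕ, m = (n : ℕ∞) ∧ relInjDimLE XX M n}

/-- `pd_XX(M) ≤ n` : `Ext^j(M, X) = 0` for all `X ∈ XX` and `j > n`. -/
def relProjDimLE (XX : Set C) (M : C) (n : ℕ) : Prop :=
  ∀ X ∈ XX, ∀ j : ℕ, n < j → Subsingleton (Abelian.Ext.{w} M X j)

/-- The relative projective dimension `pd_XX(M) : ℕ∞`. -/
noncomputable def relProjDim (XX : Set C) (M : C) : ℕ∞ :=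
  sInf {m : ℕ∞ | ∃ n : ℕ, m = (n : ℕ∞) ∧ relProjDimLE XX M n}

/-- There is an exact sequence `0 → X_n → ⋯ → X_0 → M → 0` with all `X_i ∈ XX`
(a resolution of length `n`). -/
inductive HasResolutionLength (XX : Set C) : ℕ → C → Prop
  | zero {M X : C} (hX : X ∈ XX) (e : X ≅ M) : HasResolutionLength XX 0 M
  | succ {n : ℕ} {M : C} (K X : C) (hX : X ∈ XX)
      (i : K ⟶ X) (p : X ⟶ M) (hse : IsShortExactSeq i p)
      (hK : HasResolutionLength XX n K) : HasResolutionLength XX (n + 1) M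

/-- The `XX`-resolution dimension `resdim_XX(M) : ℕ∞`. -/
noncomputable def resDim (XX : Set C) (M : C) : ℕ∞ :=
  sInf {m : ℕ∞ | ∃ n : ℕ, m = (n : ℕ∞) ∧ HasResolutionLength XX n M}

/-- `XX^∧`, the class of objects with a finite `XX`-resolution. -/
def resHat (XX : Set C) : Set C :=
  {M | ∃ n : ℕ, HasResolutionLength XX n M}

/-- There is an exact sequence `0 → M → X^0 → ⋯ → X^n → 0` with all `X^i ∈ XX`
(a coresolution of length `n`). -/
inductive HasCoresolutionLength (XX : Set C) : ℕ → C → Prop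
  | zero {M X : C} (hX : X ∈ XX) (e : M ≅ X) : HasCoresolutionLength XX 0 M
  | succ {n : ℕ} {M : C} (X Q : C) (hX : X ∈ XX)
      (i : M ⟶ X) (p : X ⟶ Q) (hse : IsShortExactSeq i p)
      (hQ : HasCoresolutionLength XX n Q) : HasCoresolutionLength XX (n + 1) M

/-- The `XX`-coresolution dimension `coresdim_XX(M) : ℕ∞`. -/
noncomputable def coresDim (XX : Set C) (M : C) : ℕ∞ :=
  sInf {m : ℕ∞ | ∃ n : ℕ, m = (n : ℕ∞) ∧ HasCoresolutionLength XX n M}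

/-- `XX^∨`, the class of objects with a finite `XX`-coresolution. -/
def coresVee (XX : Set C) : Set C :=
  {M | ∃ n : ℕ, HasCoresolutionLength XX n M}

/-- `IsSyzygyOf XX n M K` : there is an exact sequence
`0 → K → X_{n-1} → ⋯ → X_0 → M → 0` with all `X_i ∈ XX`. -/
inductive IsSyzygyOf (XX : Set C) : ℕ → C → C → Prop
  | zero {M K : C} (e : K ≅ M) : IsSyzygyOf XX 0 M K
  | succ {n : ℕ} {M : C} (K X L : C) (hX : X ∈ XX)
      (i : K ⟶ X) (p : X ⟶ L) (hse : IsShortExactSeq i p)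
      (hL : IsSyzygyOf XX n M L) : IsSyzygyOf XX (n + 1) M K

/-- `XX^⊥ = {N | Ext^i(X, N) = 0 for all X ∈ XX, i > 0}`. -/
def rightPerp (XX : Set C) : Set C :=
  {N | ∀ X ∈ XX, ∀ i : ℕ, 0 < i → Subsingleton (Abelian.Ext.{w} X N i)}

/-- `XX^{⊥₁} = {N | Ext^1(X, N) = 0 for all X ∈ XX}`. -/
def rightPerp1 (XX : Set C) : Set C :=
  {N | ∀ X ∈ XX, Subsingleton (Abelian.Ext.{w} X N 1)}

/-- `^⊥XX = {N | Ext^i(N, X) = 0 for all X ∈ XX, i > 0}`. -/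
def leftPerp (XX : Set C) : Set C :=
  {N | ∀ X ∈ XX, ∀ i : ℕ, 0 < i → Subsingleton (Abelian.Ext.{w} N X i)}

/-- `^{⊥₁}XX = {N | Ext^1(N, X) = 0 for all X ∈ XX}`. -/
def leftPerp1 (XX : Set C) : Set C :=
  {N | ∀ X ∈ XX, Subsingleton (Abelian.Ext.{w} N X 1)}

/-- Closed under extensions. -/
def ClosedUnderExtensions (XX : Set C) : Prop :=
  ∀ ⦃A B C' : C⦄ (f : A ⟶ B) (g : B ⟶ C'), IsShortExactSeq f g →
    A ∈ XX → C' ∈ XX → B ∈ XX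

/-- Closed under kernels of epimorphisms between objects of the class. -/
def ClosedUnderKernelsOfEpis (XX : Set C) : Prop :=
  ∀ ⦃A B C' : C⦄ (f : A ⟶ B) (g : B ⟶ C'), IsShortExactSeq f g →
    B ∈ XX → C' ∈ XX → A ∈ XX

/-- Closed under cokernels of monomorphisms between objects of the class. -/
def ClosedUnderCokernelsOfMonos (XX : Set C) : Prop :=
  ∀ ⦃A B C' : C⦄ (f : A ⟶ B) (g : B ⟶ C'), IsShortExactSeq f g →
    A ∈ XX → B ∈ XX → C' ∈ XX

/-- Closed under direct summands (retracts) in `C`. -/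
def ClosedUnderSummands (XX : Set C) : Prop :=
  ∀ ⦃X A : C⦄, X ∈ XX → ∀ (s : A ⟶ X) (r : X ⟶ A), s ≫ r = 𝟙 A → A ∈ XX

/-- Pre-resolving class: closed under extensions and kernels of epimorphisms. -/
def IsPreresolving (XX : Set C) : Prop :=
  ClosedUnderExtensions XX ∧ ClosedUnderKernelsOfEpis XX

/-- Pre-coresolving class: closed under extensions and cokernels of monomorphisms. -/
def IsPrecoresolving (XX : Set C) : Prop :=
  ClosedUnderExtensions XX ∧ ClosedUnderCokernelsOfMonos XX

/-- Left thick class. -/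
def IsLeftThick (XX : Set C) : Prop :=
  IsPreresolving XX ∧ ClosedUnderSummands XX

/-- Right thick class. -/
def IsRightThick (XX : Set C) : Prop :=
  IsPrecoresolving XX ∧ ClosedUnderSummands XX

/-- Thick class. -/
def IsThickClass (XX : Set C) : Prop :=
  IsLeftThick XX ∧ IsRightThick XX

/-- The smallest thick class of `C` containing `S`. -/
def thickClosure (S : Set C) : Set C :=
  ⋂₀ {T : Set C | IsThickClass T ∧ S ⊆ T}

/-- The class of projective objects of `C`. -/
def ProjClass (C : Type u) [Category.{v} C] : Set C := {P | Projective P}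

/-- The class of injective objects of `C`. -/
def InjClass (C : Type u) [Category.{v} C] : Set C := {I | Injective I}

/-- Resolving class in `C`: pre-resolving and containing all projectives. -/
def IsResolvingClass (XX : Set C) : Prop :=
  IsPreresolving XX ∧ ProjClass C ⊆ XX

/-- Coresolving class in `C`: pre-coresolving and containing all injectives. -/
def IsCoresolvingClass (XX : Set C) : Prop :=
  IsPrecoresolving XX ∧ InjClass C ⊆ XX

/-- A left Frobenius pair `(XX, ωω)` in `C`. -/
structure LeftFrobeniusPair (XX ωω : Set C) : Prop where
  leftThick : IsLeftThick XX
  relInj : IsRelInjective XX ωω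
  relCogen : IsRelCogenerator XX ωω
  summands : ClosedUnderSummands ωω

/-- A strong left Frobenius pair `(XX, ωω)` in `C`. -/
structure StrongLeftFrobeniusPair (XX ωω : Set C) extends LeftFrobeniusPair XX ωω : Prop where
  relProj : IsRelProjective XX ωω
  relGen : IsRelGenerator XX ωω

/-- A right Frobenius pair `(νν, YY)` in `C`. -/
structure RightFrobeniusPair (νν YY : Set C) : Prop where
  rightThick : IsRightThick YY
  relProj : IsRelProjective YY νν
  relGen : IsRelGenerator YY νν
  summands : ClosedUnderSummands νν

/-- `φ : X ⟶ M` is an `XX`-precover of `M`. -/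
def IsPrecover (XX : Set C) {X M : C} (φ : X ⟶ M) : Prop :=
  X ∈ XX ∧ ∀ (X' : C), X' ∈ XX → ∀ f : X' ⟶ M, ∃ h : X' ⟶ X, h ≫ φ = f

/-- `φ : M ⟶ Y` is an `XX`-preenvelope of `M`. -/
def IsPreenvelope (XX : Set C) {M Y : C} (φ : M ⟶ Y) : Prop :=
  Y ∈ XX ∧ ∀ (Y' : C), Y' ∈ XX → ∀ f : M ⟶ Y', ∃ h : Y ⟶ Y', φ ≫ h = f

/-- A left `S`-cotorsion pair `(F, G)` in `C`. -/
def IsLeftCotorsionPair (S F G : Set C) : Prop :=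
  F ⊆ S ∧ G ⊆ S ∧
  F = {A | A ∈ S ∧ ∀ G' ∈ G, Subsingleton (Abelian.Ext.{w} A G' 1)} ∧
  ∀ s ∈ S, ∃ (G' F' : C) (i : G' ⟶ F') (p : F' ⟶ s),
    G' ∈ G ∧ F' ∈ F ∧ IsShortExactSeq i p

/-- A right `S`-cotorsion pair `(F, G)` in `C`. -/
def IsRightCotorsionPair (S F G : Set C) : Prop :=
  F ⊆ S ∧ G ⊆ S ∧
  G = {A | A ∈ S ∧ ∀ F' ∈ F, Subsingleton (Abelian.Ext.{w} F' A 1)} ∧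
  ∀ s ∈ S, ∃ (G' F' : C) (i : s ⟶ G') (p : G' ⟶ F'),
    G' ∈ G ∧ F' ∈ F ∧ IsShortExactSeq i p

/-- An `S`-cotorsion pair `(F, G)` in `C`. -/
def IsCotorsionPair (S F G : Set C) : Prop :=
  IsLeftCotorsionPair S F G ∧ IsRightCotorsionPair S F G

/-- A left weak AB context `(AA, BB)` in `C`. -/
structure LeftWeakABContext (AA BB : Set C) : Prop where
  frob : LeftFrobeniusPair AA (AA ∩ BB)
  rightThick : IsRightThick BB
  sub : BB ⊆ resHat AA

/-- A retract of an object with vanishing `Ext^n(X, -)` has vanishing `Ext^n(X, -)`. -/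
lemma subsingleton_ext_of_retract {X A B : C} (s : A ⟶ B) (r : B ⟶ A) (h : s ≫ r = 𝟙 A)
    (n : ℕ) (hB : Subsingleton (Abelian.Ext.{w} X B n)) :
    Subsingleton (Abelian.Ext.{w} X A n) := by
  have key (x : Abelian.Ext.{w} X A n) :
      (x.comp (Abelian.Ext.mk₀ s) (add_zero n)).comp (Abelian.Ext.mk₀ r) (add_zero n) = x := by
    simp [h]
  refine ⟨fun x y ↦ ?_⟩
  rw [← key x, ← key y, Subsingleton.elim (x.comp (Abelian.Ext.mk₀ s) (add_zero n))]

/-- The cokernel in a short exact sequence inherits the vanishing of `Ext^n(X, -)` from the middle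
term when `Ext^(n+1)(X, -)` vanishes on the kernel. -/
lemma subsingleton_ext_of_shortExact {X A B D : C} {f : A ⟶ B} {g : B ⟶ D}
    (hS : IsShortExactSeq f g) (n : ℕ) (hA : Subsingleton (Abelian.Ext.{w} X A (n + 1)))
    (hB : Subsingleton (Abelian.Ext.{w} X B n)) :
    Subsingleton (Abelian.Ext.{w} X D n) := by
  obtain ⟨_, hS⟩ := hS
  refine subsingleton_of_forall_eq 0 fun x ↦ ?_
  obtain ⟨y, hy⟩ := Abelian.Ext.covariant_sequence_exact₃ X hS x rfl
    (hA.elim (α := Abelian.Ext.{w} X A (n + 1)) _ _)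
  rw [← hy, hB.elim y 0, Abelian.Ext.zero_comp]

/-- A short exact sequence `0 → A → B → D → 0` with `Ext^1(D, A) = 0` splits. -/
lemma exists_retraction_of_subsingleton_ext {A B D : C} {f : A ⟶ B} {g : B ⟶ D}
    (hS : IsShortExactSeq f g) (h : Subsingleton (Abelian.Ext.{w} D A 1)) :
    ∃ r : B ⟶ A, f ≫ r = 𝟙 A := by
  obtain ⟨_, hS⟩ := hS
  obtain ⟨y, hy⟩ := Abelian.Ext.contravariant_sequence_exact₁ hS A
    (Abelian.Ext.mk₀ (𝟙 A)) (n₁ := 1) rfl (h.elim (α := Abelian.Ext.{w} D A 1) _ _)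
  obtain ⟨r, rfl⟩ := Abelian.Ext.addEquiv₀.symm.surjective y
  exact ⟨r, Abelian.Ext.addEquiv₀.symm.injective (by simpa using hy)⟩

lemma relInjDim_eq_zero_iff {XX : Set C} {M : C} :
    relInjDim.{w} XX M = 0 ↔ relInjDimLE.{w} XX M 0 := by
  constructor
  · intro h
    have hne : {m : ℕ∞ | ∃ n : ℕ, m = (n : ℕ∞) ∧ relInjDimLE.{w} XX M n}.Nonempty := by
      by_contra hne
      rw [Set.not_nonempty_iff_eq_empty] at hne
      simp [relInjDim, hne] at h
    obtain ⟨n, hn, hM⟩ := csInf_mem hne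
    obtain rfl : n = 0 := by exact_mod_cast hn.symm.trans h
    exact hM
  · intro h
    exact le_antisymm (sInf_le ⟨0, by simp, h⟩) bot_le

lemma IsRelInjective.resHat {XX ωω : Set C} (hinj : IsRelInjective.{w} XX ωω) :
    IsRelInjective.{w} XX (resHat ωω) := by
  rintro M ⟨n, hM⟩ X hX
  induction hM with
  | zero hW e =>
    exact fun i hi ↦ subsingleton_ext_of_retract e.inv e.hom e.inv_hom_id i (hinj _ hW X hX i hi)
  | succ K W hW _ _ hse _ ih =>
    exact fun i hi ↦ subsingleton_ext_of_shortExact hse i (ih _ i.succ_pos) (hinj W hW X hX i hi)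

/-- An object of `XX` on which the higher `Ext` groups from `XX` vanish lies in any
summand-closed relative cogenerator. -/
lemma IsRelCogenerator.mem_of_relInjDimLE_zero {XX ωω : Set C} (hcog : IsRelCogenerator XX ωω)
    (hsum : ClosedUnderSummands ωω) {A : C} (hA : A ∈ XX) (h : relInjDimLE.{w} XX A 0) :
    A ∈ ωω := by
  obtain ⟨W, X', f, g, hW, hX', hse⟩ := hcog.2 A hA
  obtain ⟨r, hr⟩ := exists_retraction_of_subsingleton_ext hse (h X' hX' 1 one_pos)
  exact hsum hW f r hr

/-- Proposition AB2. If `ω` is `X`-injective then (a) `ω^∧` is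
`X`-injective, and (b) if moreover `ω` is a relative cogenerator in `X` closed under
direct summands, then `ω = {X ∈ X : id_X(X) = 0} = X ∩ ω^∧`. -/
theorem stmt0 (XX ωω : Set C) (hinj : IsRelInjective XX ωω) :
    IsRelInjective XX (resHat ωω) ∧
    ((IsRelCogenerator XX ωω ∧ ClosedUnderSummands ωω) →
      ωω = {A | A ∈ XX ∧ relInjDim XX A = 0} ∧ ωω = XX ∩ resHat ωω) := by
  refine ⟨hinj.resHat, fun ⟨hcog, hsum⟩ ↦ ⟨?_, ?_⟩⟩
  · ext A
    exact ⟨fun hA ↦ ⟨hcog.1 hA, relInjDim_eq_zero_iff.2 (hinj A hA)⟩,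
      fun hA ↦ hcog.mem_of_relInjDimLE_zero hsum hA.1 (relInjDim_eq_zero_iff.1 hA.2)⟩
  · ext A
    exact ⟨fun hA ↦ ⟨hcog.1 hA, 0, .zero hA (Iso.refl A)⟩,
      fun hA ↦ hcog.mem_of_relInjDimLE_zero hsum hA.1 (hinj.resHat A hA.2)⟩

end ABFormal
end

section
/- Let C be an abelian category and (X,ω) a pair of classes of objects of C such that ω is X-injective, ω is a relative cogenerator in X, and ω is closed under direct summands in C. Then X ∩ ω^∨ = {X ∈ X : id_X(X) < ∞}, and moreover id_X(M) = coresdim_ω(M) for every M ∈ X ∩ ω^∨. -/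
/-!
Common definitions for Auslander–Buchweitz approximation theory in abelian
categories, following Becerril–Mendoza–Pérez–Santiago.
-/

open CategoryTheory CategoryTheory.Limits ZeroObject

universe w v u

namespace ABFormal

variable {C : Type u} [Category.{v} C] [Abelian C] [CategoryTheory.HasExt.{w} C]

/-- Relative injective dimension is bounded by the length of a coresolution by relative
injectives. -/
theorem HasCoresolutionLength.relInjDimLE {XX ωω : Set C} (hinj : IsRelInjective.{w} XX ωω)
    {n : ℕ} {M : C} (h : HasCoresolutionLength ωω n M) : relInjDimLE.{w} XX M n := by
  induction h with
  | zero hW e =>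
    intro X hX j hj
    have := hinj _ hW X hX j hj
    refine subsingleton_of_forall_eq 0 fun x => ?_
    rw [← x.comp_mk₀_id, ← e.hom_inv_id, ← Abelian.Ext.mk₀_comp_mk₀,
      ← Abelian.Ext.comp_assoc_of_third_deg_zero,
      Subsingleton.elim (x.comp (Abelian.Ext.mk₀ e.hom) (add_zero j)) 0, Abelian.Ext.zero_comp]
  | succ W Q hW i p hse _ ih =>
    intro X hX j hj
    obtain ⟨_, hS⟩ := hse
    obtain ⟨k, rfl⟩ : ∃ k, j = k + 1 := ⟨j - 1, by omega⟩
    have := hinj W hW X hX (k + 1) k.succ_pos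
    have := ih X hX k (by omega)
    refine subsingleton_of_forall_eq 0 fun x => ?_
    obtain ⟨y, rfl⟩ := Abelian.Ext.covariant_sequence_exact₁ X hS x (Subsingleton.elim _ _) rfl
    rw [Subsingleton.elim y 0, Abelian.Ext.zero_comp]

/-- A short exact sequence `0 → A → B → C' → 0` with `Ext¹(C', A) = 0` has a retraction. -/
theorem IsShortExactSeq.exists_retraction {A B C' : C} {f : A ⟶ B} {g : B ⟶ C'}
    (h : IsShortExactSeq f g) [Subsingleton (Abelian.Ext.{w} C' A 1)] :
    ∃ r : B ⟶ A, f ≫ r = 𝟙 A := by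
  obtain ⟨_, hS⟩ := h
  obtain ⟨y, hy⟩ := Abelian.Ext.contravariant_sequence_exact₁ hS A
    (Abelian.Ext.mk₀ (𝟙 A)) (add_zero 1) (Subsingleton.elim (α := Abelian.Ext.{w} C' A 1) _ _)
  obtain ⟨r, rfl⟩ := Abelian.Ext.addEquiv₀.symm.surjective y
  exact ⟨r, Abelian.Ext.addEquiv₀.symm.injective (by simpa using hy)⟩

/-- An object of `XX` of relative injective dimension at most `n` has a coresolution of length `n`
by objects of a relatively injective cogenerator. -/
theorem relInjDimLE.hasCoresolutionLength {XX ωω : Set C} (hinj : IsRelInjective.{w} XX ωω)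
    (hcog : IsRelCogenerator XX ωω) (hsum : ClosedUnderSummands ωω) {n : ℕ} {M : C}
    (hM : M ∈ XX) (h : relInjDimLE.{w} XX M n) : HasCoresolutionLength ωω n M := by
  induction n generalizing M with
  | zero =>
    obtain ⟨W, X', i, p, hW, hX', hse⟩ := hcog.2 M hM
    have := h X' hX' 1 one_pos
    obtain ⟨r, hr⟩ := hse.exists_retraction
    exact .zero (hsum hW i r hr) (Iso.refl M)
  | succ n ih =>
    obtain ⟨W, X', i, p, hW, hX', hse⟩ := hcog.2 M hM
    refine .succ W X' hW i p hse (ih hX' fun X hX j hj => ?_)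
    obtain ⟨_, hS⟩ := hse
    have := hinj W hW X hX j (by omega)
    have := h X hX (j + 1) (by omega)
    refine subsingleton_of_forall_eq 0 fun x => ?_
    obtain ⟨y, rfl⟩ := Abelian.Ext.covariant_sequence_exact₃ X hS x rfl (Subsingleton.elim _ _)
    rw [Subsingleton.elim y 0, Abelian.Ext.zero_comp]

theorem relInjDim_lt_top_iff {XX : Set C} {M : C} :
    relInjDim.{w} XX M < ⊤ ↔ ∃ n, relInjDimLE.{w} XX M n := by
  rw [relInjDim, sInf_lt_iff]
  constructor
  · rintro ⟨_, ⟨n, rfl, hn⟩, _⟩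
    exact ⟨n, hn⟩
  · rintro ⟨n, hn⟩
    exact ⟨n, ⟨n, rfl, hn⟩, ENat.natCast_lt_top n⟩

/-- Lemma AB3. If `ω` is an `X`-injective relative cogenerator in `X`,
closed under direct summands, then `X ∩ ω^∨ = {X ∈ X : id_X(X) < ∞}` and
`id_X(M) = coresdim_ω(M)` for every `M ∈ X ∩ ω^∨`. -/
theorem stmt1 (XX ωω : Set C) (hinj : IsRelInjective XX ωω)
    (hcog : IsRelCogenerator XX ωω) (hsum : ClosedUnderSummands ωω) :
    XX ∩ coresVee ωω = {A | A ∈ XX ∧ relInjDim XX A < ⊤} ∧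
    ∀ M ∈ XX ∩ coresVee ωω, relInjDim XX M = coresDim ωω M := by
  have key (n : ℕ) {M : C} (hM : M ∈ XX) :
      relInjDimLE XX M n ↔ HasCoresolutionLength ωω n M :=
    ⟨fun h => h.hasCoresolutionLength hinj hcog hsum hM, fun h => h.relInjDimLE hinj⟩
  constructor
  · ext M
    refine and_congr_right fun hM => ?_
    rw [relInjDim_lt_top_iff]
    exact exists_congr fun n => (key n hM).symm
  · rintro M ⟨hM, _⟩
    simp only [relInjDim, coresDim, key _ hM]

end ABFormal
end

section
/- Let C be an abelian category and (X,ω) a pair of classes of objects of C such that X is closed under extensions, the zero object belongs to X, and ω is a relative cogenerator in X. Then for any object C' of C with resdim_X(C') = n < ∞ there exist short exact sequences 0 → K → X → C' → 0 with X ∈ X and resdim_ω(K) = n − 1 (where resdim_ω(K) = −1 means K = 0), and 0 → C' → H → X' → 0 with X' ∈ X and resdim_ω(H) ≤ n. -/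
/-!
Common definitions for Auslander–Buchweitz approximation theory in abelian
categories, following Becerril–Mendoza–Pérez–Santiago.
-/

open CategoryTheory CategoryTheory.Limits ZeroObject

universe w v u

namespace ABFormal

variable {C : Type u} [Category.{v} C] [Abelian C] [CategoryTheory.HasExt.{w} C]

section

variable {𝒜 : Type u} [Category.{v} 𝒜] [Abelian 𝒜]

lemma isShortExactSeq_of_desc {A B D : 𝒜} (f : A ⟶ B) (g : B ⟶ D) [Mono f] [Epi g]
    (w : f ≫ g = 0) (hdesc : ∀ {T : 𝒜} (k : B ⟶ T), f ≫ k = 0 → ∃ l, g ≫ l = k) :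
    IsShortExactSeq f g := by
  refine ⟨w, ShortComplex.ShortExact.mk' (ShortComplex.exact_of_g_is_cokernel _ ?_) ‹_› ‹_›⟩
  exact CokernelCofork.IsColimit.ofπ' g w fun k hk ↦ ⟨(hdesc k hk).choose, (hdesc k hk).choose_spec⟩

namespace IsShortExactSeq

variable {A B D : 𝒜} {f : A ⟶ B} {g : B ⟶ D}

lemma mono (h : IsShortExactSeq f g) : Mono f := h.choose_spec.mono_f

lemma epi (h : IsShortExactSeq f g) : Epi g := h.choose_spec.epi_g

lemma exists_desc (h : IsShortExactSeq f g) {T : 𝒜} (k : B ⟶ T) (hk : f ≫ k = 0) :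
    ∃ l, g ≫ l = k :=
  ⟨_, (CokernelCofork.IsColimit.desc' h.choose_spec.gIsCokernel k hk).2⟩

/-- The pushout of a short exact sequence along a morphism out of its first term. -/
lemma exists_of_isPushout (h : IsShortExactSeq f g) {A' P : 𝒜} {a : A ⟶ A'} {j : B ⟶ P}
    {k : A' ⟶ P} (sq : IsPushout f a j k) :
    ∃ q : P ⟶ D, j ≫ q = g ∧ IsShortExactSeq k q := by
  have := h.mono
  have := h.epi
  have : Mono k := Abelian.mono_inr_of_isColimit _ _ sq.isColimit
  have w : f ≫ g = a ≫ 0 := by rw [h.choose, comp_zero]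
  have hq : j ≫ sq.desc g 0 w = g := sq.inl_desc _ _ _
  have : Epi (sq.desc g 0 w) := epi_of_epi_fac hq
  refine ⟨sq.desc g 0 w, hq, isShortExactSeq_of_desc _ _ (sq.inr_desc _ _ _) fun r hr ↦ ?_⟩
  obtain ⟨l, hl⟩ := h.exists_desc (j ≫ r) (by rw [sq.w_assoc, hr, comp_zero])
  refine ⟨l, sq.hom_ext ?_ ?_⟩
  · rw [reassoc_of% hq, hl]
  · rw [sq.inr_desc_assoc, zero_comp, hr]

/-- The pushout of an epimorphism along a monomorphism has the same kernel. -/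
lemma comp_mono_of_isPushout (h : IsShortExactSeq f g) {W Q : 𝒜} {j : B ⟶ W} [Mono j]
    {k : W ⟶ Q} {c : D ⟶ Q} (sq : IsPushout j g k c) :
    IsShortExactSeq (f ≫ j) k := by
  have := h.mono
  have := h.epi
  have : Epi k := ⟨fun u v huv ↦ sq.hom_ext huv (by
    rw [← cancel_epi g, ← sq.w_assoc, huv, sq.w_assoc])⟩
  refine isShortExactSeq_of_desc _ _ ?_ fun r hr ↦ ?_
  · rw [Category.assoc, sq.w, ← Category.assoc, h.choose, zero_comp]
  · obtain ⟨l, hl⟩ := h.exists_desc (j ≫ r) (by rw [← Category.assoc, hr])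
    exact ⟨sq.desc r l hl.symm, sq.inl_desc _ _ _⟩

end IsShortExactSeq

/-- Push out an approximation sequence of `M` along an embedding of its middle term into an
object of the cogenerating class. -/
lemma exists_coapproximation {XX ωω : Set 𝒜} (hcog : IsRelCogenerator XX ωω) {K X M : 𝒜} {n : ℕ}
    (hX : X ∈ XX) {i : K ⟶ X} {p : X ⟶ M} (h : IsShortExactSeq i p)
    (hK : HasResolutionLength ωω n K) :
    ∃ (H X' : 𝒜) (φ : M ⟶ H) (q : H ⟶ X'), X' ∈ XX ∧ IsShortExactSeq φ q ∧
      HasResolutionLength ωω (n + 1) H := by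
  obtain ⟨W, X', j, r, hW, hX', hjr⟩ := hcog.2 X hX
  have := hjr.mono
  have sq := IsPushout.of_hasPushout j p
  obtain ⟨q, -, hq⟩ := hjr.exists_of_isPushout sq
  exact ⟨_, X', _, q, hX', hq, .succ K W hW _ _ (h.comp_mono_of_isPushout sq) hK⟩

/-- Push out a short exact sequence whose middle term lies in an extension-closed class along a
coapproximation of its first term. -/
lemma exists_approximation_of_coapproximation {XX : Set 𝒜} (hext : ClosedUnderExtensions XX)
    {K X M H X' : 𝒜} (hX : X ∈ XX) (hX' : X' ∈ XX) {i : K ⟶ X} {p : X ⟶ M}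
    (h : IsShortExactSeq i p) {φ : K ⟶ H} {q : H ⟶ X'} (hφ : IsShortExactSeq φ q) :
    ∃ (P : 𝒜) (k : H ⟶ P) (r : P ⟶ M), P ∈ XX ∧ IsShortExactSeq k r := by
  have sq := IsPushout.of_hasPushout i φ
  obtain ⟨r, -, hr⟩ := h.exists_of_isPushout sq
  obtain ⟨s, -, hs⟩ := hφ.exists_of_isPushout sq.flip
  exact ⟨_, _, r, hext _ _ hs hX hX', hr⟩

lemma HasResolutionLength.exists_coapproximation {XX ωω : Set 𝒜}
    (hext : ClosedUnderExtensions XX) (hcog : IsRelCogenerator XX ωω) {n : ℕ} {M : 𝒜}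
    (h : HasResolutionLength XX n M) :
    ∃ (H X' : 𝒜) (φ : M ⟶ H) (q : H ⟶ X'), X' ∈ XX ∧ IsShortExactSeq φ q ∧
      HasResolutionLength ωω n H := by
  induction h with
  | @zero M X hX e =>
    obtain ⟨W, X', j, r, hW, hX', hjr⟩ := hcog.2 X hX
    have := hjr.mono
    have := hjr.epi
    refine ⟨W, X', e.inv ≫ j, r, hX', isShortExactSeq_of_desc _ _ ?_ fun k hk ↦ ?_,
      .zero hW (Iso.refl W)⟩
    · rw [Category.assoc, hjr.choose, comp_zero]
    · rw [Category.assoc, Preadditive.IsIso.comp_left_eq_zero] at hk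
      exact hjr.exists_desc k hk
  | succ K X hX i p hse _ ih =>
    obtain ⟨H, X', φ, q, hX', hφ, hH⟩ := ih
    obtain ⟨P, k, r, hP, hkr⟩ :=
      exists_approximation_of_coapproximation hext hX hX' hse hφ
    exact ABFormal.exists_coapproximation hcog hP hkr hH

lemma HasResolutionLength.exists_approximation {XX ωω : Set 𝒜}
    (hext : ClosedUnderExtensions XX) (hcog : IsRelCogenerator XX ωω) {n : ℕ} {M : 𝒜}
    (h : HasResolutionLength XX (n + 1) M) :
    ∃ (K X : 𝒜) (i : K ⟶ X) (p : X ⟶ M), X ∈ XX ∧ IsShortExactSeq i p ∧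
      HasResolutionLength ωω n K := by
  cases h with
  | succ K X hX i p hse hK =>
    obtain ⟨H, X', φ, q, hX', hφ, hH⟩ := hK.exists_coapproximation hext hcog
    obtain ⟨P, k, r, hP, hkr⟩ :=
      exists_approximation_of_coapproximation hext hX hX' hse hφ
    exact ⟨H, P, k, r, hP, hkr, hH⟩

lemma HasResolutionLength.mono {XX YY : Set 𝒜} (hle : XX ⊆ YY) {n : ℕ} {M : 𝒜}
    (h : HasResolutionLength XX n M) : HasResolutionLength YY n M := by
  induction h with
  | zero hX e => exact .zero (hle hX) e
  | succ K X hX i p hse _ ih => exact .succ K X (hle hX) i p hse ih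

lemma HasResolutionLength.resDim_le {XX : Set 𝒜} {n : ℕ} {M : 𝒜}
    (h : HasResolutionLength XX n M) : resDim XX M ≤ n :=
  sInf_le ⟨n, rfl, h⟩

lemma hasResolutionLength_of_resDim_eq {XX : Set 𝒜} {n : ℕ} {M : 𝒜}
    (h : resDim XX M = n) : HasResolutionLength XX n M := by
  have hne : {m : ℕ∞ | ∃ n : ℕ, m = (n : ℕ∞) ∧ HasResolutionLength XX n M}.Nonempty := by
    by_contra hempty
    rw [Set.not_nonempty_iff_eq_empty] at hempty
    rw [resDim, hempty, sInf_empty] at h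
    exact ENat.natCast_ne_top n h.symm
  obtain ⟨m, hm, hres⟩ := csInf_mem hne
  have hnm : (n : ℕ∞) = m := h.symm.trans hm
  rwa [Nat.cast_injective hnm]

end

/-- Theorem AB4 (a). If `X` is closed under extensions, `0 ∈ X`,
and `ω` is a relative cogenerator in `X`, then any `C'` with `resdim_X(C') = n < ∞`
fits in short exact sequences `0 → K → X → C' → 0` with `X ∈ X` and
`resdim_ω(K) = n − 1` (where `−1` means `K = 0`), and `0 → C' → H → X' → 0`
with `X' ∈ X` and `resdim_ω(H) ≤ n`. -/
theorem stmt2 (XX ωω : Set C) (hext : ClosedUnderExtensions XX)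
    (h0 : (0 : C) ∈ XX) (hcog : IsRelCogenerator XX ωω)
    (C' : C) (n : ℕ) (hres : resDim XX C' = (n : ℕ∞)) :
    (∃ (K X : C) (i : K ⟶ X) (φ : X ⟶ C'), X ∈ XX ∧ IsShortExactSeq i φ ∧
      ((n = 0 ∧ IsZero K) ∨ ∃ m : ℕ, n = m + 1 ∧ resDim ωω K = (m : ℕ∞))) ∧
    (∃ (H X' : C) (φ' : C' ⟶ H) (p : H ⟶ X'), X' ∈ XX ∧ IsShortExactSeq φ' p ∧
      resDim ωω H ≤ (n : ℕ∞)) := by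
  have h := hasResolutionLength_of_resDim_eq hres
  constructor
  · cases n with
    | zero =>
      cases h with
      | @zero _ X hX e =>
        refine ⟨0, X, 0, e.hom, hX, isShortExactSeq_of_desc _ _ zero_comp fun k _ ↦
          ⟨e.inv ≫ k, e.hom_inv_id_assoc k⟩, .inl ⟨rfl, isZero_zero C⟩⟩
    | succ m =>
      obtain ⟨K, X, i, p, hX, hse, hK⟩ := h.exists_approximation hext hcog
      refine ⟨K, X, i, p, hX, hse, .inr ⟨m, rfl, le_antisymm hK.resDim_le (le_sInf ?_)⟩⟩
      rintro _ ⟨k, rfl, hk⟩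
      have hle := (HasResolutionLength.succ K X hX i p hse (hk.mono hcog.1)).resDim_le
      rw [hres, Nat.cast_le] at hle
      exact Nat.cast_le.2 (Nat.le_of_succ_le_succ hle)
  · obtain ⟨H, X', φ, q, hX', hφ, hH⟩ := h.exists_coapproximation hext hcog
    exact ⟨H, X', φ, q, hX', hφ, hH.resDim_le⟩

end ABFormal
end

section
/- Let C be an abelian category and (X,ω) a pair of classes of objects of C such that X is closed under extensions and direct summands in C and ω is a relative cogenerator in X. If an object C' of C satisfies resdim_X(C') ≤ 1 and Ext^1_C(C',W) = 0 for every W ∈ ω, then C' ∈ X. -/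
/-!
Common definitions for Auslander–Buchweitz approximation theory in abelian
categories, following Becerril–Mendoza–Pérez–Santiago.
-/

open CategoryTheory CategoryTheory.Limits ZeroObject

universe w v u

namespace ABFormal

variable {C : Type u} [Category.{v} C] [Abelian C] [CategoryTheory.HasExt.{w} C]

/-- Short exact sequences are stable under pushout along the left-hand object. -/
lemma IsShortExactSeq.pushout {A B D A' P : C} {f : A ⟶ B} {g : B ⟶ D}
    (h : IsShortExactSeq f g) {a : A ⟶ A'} {inl : B ⟶ P} {inr : A' ⟶ P}
    (sq : IsPushout f a inl inr) :
    IsShortExactSeq inr (sq.desc g 0 (by rw [h.choose, comp_zero])) := by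
  obtain ⟨w, hS⟩ := h
  have : Mono f := hS.mono_f
  have : Epi g := hS.epi_g
  have : Mono inr := (MorphismProperty.monomorphisms C).of_isPushout sq.flip ‹Mono f›
  set q : P ⟶ D := sq.desc g 0 (by rw [w, comp_zero])
  have hinl : inl ≫ q = g := sq.inl_desc _ _ _
  have hinr : inr ≫ q = 0 := sq.inr_desc _ _ _
  have : Epi q := epi_of_epi_fac hinl
  refine ⟨hinr, .mk' (ShortComplex.exact_of_g_is_cokernel _ ?_) ‹_› ‹_›⟩
  refine CokernelCofork.IsColimit.ofπ' q hinr fun {T} k hk => ?_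
  have hk' : f ≫ inl ≫ k = 0 := by rw [sq.w_assoc, hk, comp_zero]
  refine ⟨hS.exact.desc (inl ≫ k) hk', sq.hom_ext ?_ ?_⟩
  · rw [reassoc_of% hinl]
    exact hS.exact.g_desc _ hk'
  · rw [reassoc_of% hinr, zero_comp, hk]

/-- A short exact sequence `0 → A → B → D → 0` with `Ext^1(D, A) = 0` splits. -/
lemma IsShortExactSeq.exists_section {A B D : C} {f : A ⟶ B} {g : B ⟶ D}
    (h : IsShortExactSeq f g) (hA : Subsingleton (Abelian.Ext.{w} D A 1)) :
    ∃ s : D ⟶ B, s ≫ g = 𝟙 D := by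
  obtain ⟨w, hS⟩ := h
  obtain ⟨x, hx⟩ := Abelian.Ext.covariant_sequence_exact₃ D hS
    (Abelian.Ext.mk₀ (𝟙 D)) (zero_add 1) (Subsingleton.elim _ _)
  obtain ⟨s, rfl⟩ := (Abelian.Ext.mk₀_bijective D B).2 x
  rw [Abelian.Ext.mk₀_comp_mk₀] at hx
  exact ⟨s, (Abelian.Ext.mk₀_bijective D D).1 hx⟩

/-- A class closed under direct summands is closed under isomorphisms. -/
lemma ClosedUnderSummands.of_iso {XX : Set C} (hsum : ClosedUnderSummands XX) {X M : C}
    (hX : X ∈ XX) (e : X ≅ M) : M ∈ XX :=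
  hsum hX e.inv e.hom e.inv_hom_id

/-- The infimum defining a finite resolution dimension is attained. -/
lemma exists_hasResolutionLength_of_resDim_le {XX : Set C} {M : C} {n : ℕ}
    (h : resDim XX M ≤ n) : ∃ m ≤ n, HasResolutionLength XX m M := by
  have hlt : resDim XX M < ((n + 1 : ℕ) : ℕ∞) :=
    h.trans_lt (by exact_mod_cast n.lt_succ_self)
  obtain ⟨_, ⟨m, rfl, hm⟩, hmn⟩ := sInf_lt_iff.1 hlt
  exact ⟨m, Nat.lt_succ_iff.1 (by exact_mod_cast hmn), hm⟩

/-- Corollary AB5. If `X` is closed under extensions and direct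
summands, `ω` is a relative cogenerator in `X`, `resdim_X(C') ≤ 1` and
`Ext^1(C', W) = 0` for all `W ∈ ω`, then `C' ∈ X`. -/
theorem stmt4 (XX ωω : Set C) (hext : ClosedUnderExtensions XX)
    (hsum : ClosedUnderSummands XX) (hcog : IsRelCogenerator XX ωω)
    (C' : C) (hres : resDim XX C' ≤ (1 : ℕ∞))
    (hExt : ∀ W ∈ ωω, Subsingleton (Abelian.Ext.{w} C' W 1)) :
    C' ∈ XX := by
  obtain ⟨m, hm, hC⟩ := exists_hasResolutionLength_of_resDim_le (n := 1) (by exact_mod_cast hres)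
  cases hC with
  | zero hX e => exact hsum.of_iso hX e
  | @succ n _ K X hX i p hse hK =>
    obtain rfl : n = 0 := by omega
    cases hK with
    | zero hX₁ e =>
      obtain ⟨W, X', j, q, hW, hX', hse'⟩ := hcog.2 K (hsum.of_iso hX₁ e)
      have sq := IsPushout.of_hasPushout i j
      have hP := hext _ _ (hse'.pushout sq.flip) hX hX'
      obtain ⟨s, hs⟩ := (hse.pushout sq).exists_section (hExt W hW)
      exact hsum hP s _ hs

end ABFormal
end
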